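/- arXiv:math/0507473 — 4 statements merged into one kernel-verified Lean document; each statement's English description precedes it below -/
import Mathlib

section
/- Let a₁, a₂, a₃, b₁, b₂, b₃ be real numbers and let c = c(a,b) be the associated three-dimensional unimodular structure constants. Then the matrix R¹(c), with entries R¹(c) j k = −(1/2)·Σ_{s,m} c s m j · c m s k, is diagonal (i.e. R¹(c) j k = 0 for all j ≠ k) if and only if b₁b₃ − a₃b₂ = 0, b₂b₃ − a₂b₁ = 0, and b₁b₂ − a₁b₃ = 0. -/
open Matrix BigOperators

noncomputable section

/-- The structure constants of a three-dimensional unimodular Lie algebra, with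
parameters `a₁ a₂ a₃ b₁ b₂ b₃`: `cab a₁ a₂ a₃ b₁ b₂ b₃ k i j = C^k_{ij}`, whose only
nonzero entries are `C¹₂₃ = a₁`, `C²₃₁ = a₂`, `C³₁₂ = a₃`, `C¹₁₂ = C³₂₃ = b₁`,
`C¹₃₁ = C²₂₃ = b₂`, `C²₁₂ = C³₃₁ = b₃` and those forced by skew-symmetry. -/
def cab (a₁ a₂ a₃ b₁ b₂ b₃ : ℝ) : Fin 3 → Fin 3 → Fin 3 → ℝ :=
  fun k i j =>
    ![!![0, b₁, -b₂; -b₁, 0, a₁; b₂, -a₁, 0],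
      !![0, b₃, -a₂; -b₃, 0, b₂; a₂, -b₂, 0],
      !![0, a₃, -b₃; -a₃, 0, b₁; b₃, -b₁, 0]] k i j

/-- First piece of the Ricci tensor: `R¹(c) j k = -(1/2) Σ_{s,m} c s m j * c m s k`. -/
def R1 (c : Fin 3 → Fin 3 → Fin 3 → ℝ) (j k : Fin 3) : ℝ :=
  -(1/2) * ∑ s, ∑ m, c s m j * c m s k

/-- Second piece: `R²(c) j k = (1/2) Σ_{s,m} c m m s * (c k s j + c j s k)`. -/
def R2 (c : Fin 3 → Fin 3 → Fin 3 → ℝ) (j k : Fin 3) : ℝ :=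
  (1/2) * ∑ s, ∑ m, c m m s * (c k s j + c j s k)

/-- Third piece: `R³(c) j k = (1/4) Σ_{s,m} c j s m * c k s m`. -/
def R3 (c : Fin 3 → Fin 3 → Fin 3 → ℝ) (j k : Fin 3) : ℝ :=
  (1/4) * ∑ s, ∑ m, c j s m * c k s m

/-- Fourth piece: `R⁴(c) j k = -(1/2) Σ_{s,m} c m s j * c m s k`. -/
def R4 (c : Fin 3 → Fin 3 → Fin 3 → ℝ) (j k : Fin 3) : ℝ :=
  -(1/2) * ∑ s, ∑ m, c m s j * c m s k

/-- The Ricci matrix `R(c) = R¹(c) + R²(c) + R³(c) + R⁴(c)`. -/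
def Rtot (c : Fin 3 → Fin 3 → Fin 3 → ℝ) : Matrix (Fin 3) (Fin 3) ℝ :=
  Matrix.of fun j k => R1 c j k + R2 c j k + R3 c j k + R4 c j k

/-- The action of `GL(3)` on structure constants:
`(T_Λ(Q)c) k i j = Σ_{s,m,l} Q s i * Q m j * c l s m * (Q⁻¹) k l`. -/
def TLam (Q : Matrix (Fin 3) (Fin 3) ℝ) (c : Fin 3 → Fin 3 → Fin 3 → ℝ) :
    Fin 3 → Fin 3 → Fin 3 → ℝ :=
  fun k i j => ∑ s, ∑ m, ∑ l, Q s i * Q m j * c l s m * Q⁻¹ k l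

/-- The off-diagonal entries of `R1 (cab …)` are, up to sign, the off-diagonal minors of the
symmetric matrix `!![a₁, b₂, b₁; b₂, a₂, b₃; b₁, b₃, a₃]`. -/
lemma R1_cab_off_diagonal (a₁ a₂ a₃ b₁ b₂ b₃ : ℝ) :
    (R1 (cab a₁ a₂ a₃ b₁ b₂ b₃) 0 1 = b₁ * b₃ - a₃ * b₂) ∧
    (R1 (cab a₁ a₂ a₃ b₁ b₂ b₃) 0 2 = b₂ * b₃ - a₂ * b₁) ∧
    (R1 (cab a₁ a₂ a₃ b₁ b₂ b₃) 1 2 = b₁ * b₂ - a₁ * b₃) := by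
  refine ⟨?_, ?_, ?_⟩ <;>
  · simp [R1, cab, Fin.sum_univ_three]
    ring

/-- `R1 c` is symmetric. -/
lemma R1_symm (c : Fin 3 → Fin 3 → Fin 3 → ℝ) (j k : Fin 3) : R1 c j k = R1 c k j := by
  unfold R1
  rw [Finset.sum_comm]
  simp only [mul_comm]

/-- The Cartan–Ricci matrix `R¹(c(a,b))` is diagonal iff
`b₁b₃ − a₃b₂ = 0`, `b₂b₃ − a₂b₁ = 0`, and `b₁b₂ − a₁b₃ = 0`. -/
theorem R1_diagonal_iff (a₁ a₂ a₃ b₁ b₂ b₃ : ℝ) :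
    (∀ j k : Fin 3, j ≠ k → R1 (cab a₁ a₂ a₃ b₁ b₂ b₃) j k = 0) ↔
    (b₁ * b₃ - a₃ * b₂ = 0 ∧ b₂ * b₃ - a₂ * b₁ = 0 ∧ b₁ * b₂ - a₁ * b₃ = 0) := by
  obtain ⟨h01, h02, h12⟩ := R1_cab_off_diagonal a₁ a₂ a₃ b₁ b₂ b₃
  constructor
  · intro h
    have e01 := h 0 1 (by decide)
    have e02 := h 0 2 (by decide)
    have e12 := h 1 2 (by decide)
    refine ⟨?_, ?_, ?_⟩ <;> linarith
  · rintro ⟨e01, e02, e12⟩ j k hjk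
    wlog hlt : j < k generalizing j k
    · rw [R1_symm]
      exact this k j hjk.symm (lt_of_le_of_ne (not_lt.mp hlt) hjk.symm)
    fin_cases j <;> fin_cases k <;> simp at hlt ⊢ <;> linarith
end
end

section
/- Let a₁, a₂, a₃ be real numbers and let c = c(a,b) be the three-dimensional unimodular structure constants with b₁ = b₂ = b₃ = 0 (Case I). Then the Ricci matrix R(c) is diagonal with entries R(c) 1 1 = (1/2)·(a₁² − (a₂ − a₃)²), R(c) 2 2 = (1/2)·(−a₁² + a₂² + 2a₁a₃ − a₃²), R(c) 3 3 = (1/2)·(−a₁² + 2a₁a₂ − a₂² + a₃²), and R(c) j k = 0 for j ≠ k. -/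
open Matrix BigOperators

noncomputable section

/-- In Case I (`b₁ = b₂ = b₃ = 0`), the Ricci matrix `R(c)` is diagonal
with the stated entries. -/
theorem Ricci_case_I (a₁ a₂ a₃ : ℝ) :
    Rtot (cab a₁ a₂ a₃ 0 0 0) 0 0 = (1/2) * (a₁^2 - (a₂ - a₃)^2) ∧
    Rtot (cab a₁ a₂ a₃ 0 0 0) 1 1 = (1/2) * (-a₁^2 + a₂^2 + 2*a₁*a₃ - a₃^2) ∧
    Rtot (cab a₁ a₂ a₃ 0 0 0) 2 2 = (1/2) * (-a₁^2 + 2*a₁*a₂ - a₂^2 + a₃^2) ∧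
    (∀ j k : Fin 3, j ≠ k → Rtot (cab a₁ a₂ a₃ 0 0 0) j k = 0) := by
  refine ⟨?_, ?_, ?_, fun j k hjk => ?_⟩
  · simp [Rtot, R1, R2, R3, R4, cab, Fin.sum_univ_three]; ring
  · simp [Rtot, R1, R2, R3, R4, cab, Fin.sum_univ_three]; ring
  · simp [Rtot, R1, R2, R3, R4, cab, Fin.sum_univ_three]; ring
  · fin_cases j <;> fin_cases k <;>
      first
      | exact absurd rfl hjk
      | simp [Rtot, R1, R2, R3, R4, cab, Fin.sum_univ_three]
end
end

section
/- Let a₁, a₂, a₃ be real numbers, let c = c(a,b) be the three-dimensional unimodular structure constants with b₁ = b₂ = b₃ = 0 (Case I), and let f, g, h be nonzero reals. For Q = diag(f, g, h), the matrix R(T_Λ(Q)c) is diagonal with entries: R(T_Λ(Q)c) 1 1 = a₂a₃f² + a₁²g²h²/(2f²) − f²(a₃²g⁴ + a₂²h⁴)/(2g²h²), R(T_Λ(Q)c) 2 2 = a₁a₃g² + a₂²f²h²/(2g²) − g²(a₃²f⁴ + a₁²h⁴)/(2f²h²), R(T_Λ(Q)c) 3 3 = (a₃²f⁴g⁴ −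 (a₂f² − a₁g²)²h⁴)/(2f²g²h²), and all off-diagonal entries zero. -/
open Matrix BigOperators

noncomputable section

/-- A diagonal change of frame preserves structure constants with `b = 0`,
rescaling the three parameters. -/
theorem TLam_diagonal_cab (a₁ a₂ a₃ f g h : ℝ) (hf : f ≠ 0) (hg : g ≠ 0) (hh : h ≠ 0) :
    TLam (Matrix.diagonal ![f, g, h]) (cab a₁ a₂ a₃ 0 0 0) =
      cab (a₁ * g * h / f) (a₂ * f * h / g) (a₃ * f * g / h) 0 0 0 := by
  have hQ : (Matrix.diagonal ![f, g, h])⁻¹ = Matrix.diagonal ![f⁻¹, g⁻¹, h⁻¹] := by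
    apply Matrix.inv_eq_right_inv
    rw [Matrix.diagonal_mul_diagonal, ← Matrix.diagonal_one]
    congr 1
    ext i
    fin_cases i <;> simp [hf, hg, hh]
  funext k i j
  simp only [TLam, hQ]
  fin_cases k <;> fin_cases i <;> fin_cases j <;>
    simp [cab, Matrix.diagonal_apply] <;> ring

/-- The Ricci matrix of structure constants with `b = 0` is diagonal. -/
theorem Rtot_cab (A B C : ℝ) :
    Rtot (cab A B C 0 0 0) =
      Matrix.diagonal ![B * C + (A ^ 2 - B ^ 2 - C ^ 2) / 2,
        A * C + (B ^ 2 - A ^ 2 - C ^ 2) / 2, A * B + (C ^ 2 - A ^ 2 - B ^ 2) / 2] := by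
  ext j k
  fin_cases j <;> fin_cases k <;>
    simp [Rtot, R1, R2, R3, R4, cab, Fin.sum_univ_three] <;> ring

/-- In Case I, for `Q = diag(f, g, h)` with `f, g, h ≠ 0`, the Ricci
matrix `R(T_Λ(Q)c)` is diagonal with the stated entries. -/
theorem Ricci_case_I_diagonal_Q (a₁ a₂ a₃ f g h : ℝ)
    (hf : f ≠ 0) (hg : g ≠ 0) (hh : h ≠ 0) :
    Rtot (TLam (Matrix.diagonal ![f, g, h]) (cab a₁ a₂ a₃ 0 0 0)) 0 0 =
        a₂*a₃*f^2 + a₁^2*g^2*h^2/(2*f^2) - f^2*(a₃^2*g^4 + a₂^2*h^4)/(2*g^2*h^2) ∧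
    Rtot (TLam (Matrix.diagonal ![f, g, h]) (cab a₁ a₂ a₃ 0 0 0)) 1 1 =
        a₁*a₃*g^2 + a₂^2*f^2*h^2/(2*g^2) - g^2*(a₃^2*f^4 + a₁^2*h^4)/(2*f^2*h^2) ∧
    Rtot (TLam (Matrix.diagonal ![f, g, h]) (cab a₁ a₂ a₃ 0 0 0)) 2 2 =
        (a₃^2*f^4*g^4 - (a₂*f^2 - a₁*g^2)^2*h^4)/(2*f^2*g^2*h^2) ∧
    (∀ j k : Fin 3, j ≠ k →
        Rtot (TLam (Matrix.diagonal ![f, g, h]) (cab a₁ a₂ a₃ 0 0 0)) j k = 0) := by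
  rw [TLam_diagonal_cab a₁ a₂ a₃ f g h hf hg hh, Rtot_cab]
  refine ⟨?_, ?_, ?_, fun j k hjk => Matrix.diagonal_apply_ne _ hjk⟩ <;>
    simp only [Matrix.diagonal_apply_eq, Matrix.cons_val] <;> field_simp <;> ring
end
end

section
/- Let a₁, a₃, b₁ be real numbers and let c = c(a,b) be the three-dimensional unimodular structure constants with a₂ = b₂ = b₃ = 0 (Case II). Then the Ricci matrix R(c) has entries R(c) 1 1 = (1/2)·(a₁² − a₃²), R(c) 2 2 = (1/2)·(−a₁² + 2a₁a₃ − a₃² − 4b₁²), R(c) 3 3 = (1/2)·(−a₁² + a₃²), R(c) 1 3 = R(c) 3 1 = (a₁ + a₃)·b₁, and R(c) 1 2 = R(c) 2 1 = R(c) 2 3 = R(c) 3 2 = 0. -/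
open Matrix BigOperators

noncomputable section

/-- In Case II (`a₂ = b₂ = b₃ = 0`), the Ricci matrix `R(c)` has the
stated entries. -/
theorem Ricci_case_II (a₁ a₃ b₁ : ℝ) :
    Rtot (cab a₁ 0 a₃ b₁ 0 0) 0 0 = (1/2) * (a₁^2 - a₃^2) ∧
    Rtot (cab a₁ 0 a₃ b₁ 0 0) 1 1 = (1/2) * (-a₁^2 + 2*a₁*a₃ - a₃^2 - 4*b₁^2) ∧
    Rtot (cab a₁ 0 a₃ b₁ 0 0) 2 2 = (1/2) * (-a₁^2 + a₃^2) ∧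
    Rtot (cab a₁ 0 a₃ b₁ 0 0) 0 2 = (a₁ + a₃) * b₁ ∧
    Rtot (cab a₁ 0 a₃ b₁ 0 0) 2 0 = (a₁ + a₃) * b₁ ∧
    Rtot (cab a₁ 0 a₃ b₁ 0 0) 0 1 = 0 ∧
    Rtot (cab a₁ 0 a₃ b₁ 0 0) 1 0 = 0 ∧
    Rtot (cab a₁ 0 a₃ b₁ 0 0) 1 2 = 0 ∧
    Rtot (cab a₁ 0 a₃ b₁ 0 0) 2 1 = 0 := by
  refine ⟨?_, ?_, ?_, ?_, ?_, ?_, ?_, ?_, ?_⟩ <;>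
    simp [Rtot, R1, R2, R3, R4, cab, Fin.sum_univ_three] <;> ring
end
end
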